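/- 3√3/(π·∛4) = ∑_{n=0}^∞ (−1/27)^n · [(1/3)_n (−1/3)_n (−1/6)_n / ((1)_n³)] · (1 − 63n²). -/

import Mathlib

open Real

/-- Pochhammer symbol (x)_n = x (x+1) ⋯ (x+n-1). -/
noncomputable def poch (x : ℝ) (n : ℕ) : ℝ :=
  ∏ k ∈ Finset.range n, (x + k)

theorem poch_zero' (x : ℝ) : poch x 0 = 1 := by simp [poch]

theorem poch_succ' (x : ℝ) (n : ℕ) : poch x (n + 1) = poch x n * (x + n) := by
  simp [poch, Finset.prod_range_succ]

/-- Normalising constant of the Whipple-type sum. -/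
noncomputable def cc (m : ℕ) : ℝ :=
  poch (4/3) (2 * m) * poch (2/3) m / (poch 1 m * poch 1 (2 * m))

/-- Summand of the Whipple-type sum. -/
noncomputable def ff (m i : ℕ) : ℝ :=
  cc m * (poch (1/3) i * poch (2/3) i * poch (-1/6) i /
    (poch 1 i * poch (-1/3 - 2 * m) i * poch (2 * m + 1) i))

/-- Base term of the target series. -/
noncomputable def t0 (n : ℕ) : ℝ :=
  (-1/27 : ℝ) ^ n * (poch (1/3) n * poch (-1/3) n * poch (-1/6) n / poch 1 n ^ 3)

theorem poch_pos' (x : ℝ) (hx : 0 < x) (n : ℕ) : 0 < poch x n := by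
  unfold poch
  exact Finset.prod_pos fun k _ => by positivity

theorem third_ne (m i : ℕ) : (-1/3 - 2 * (m : ℝ) + i) ≠ 0 := by
  intro h
  have h2 : (3 * (i : ℝ)) = 6 * m + 1 := by linarith
  have h3 : 3 * i = 6 * m + 1 := by exact_mod_cast h2
  omega

theorem ff_zero (m : ℕ) : ff m 0 = cc m := by simp [ff, poch_zero']

theorem cc_zero : cc 0 = 1 := by simp [cc, poch_zero']

theorem cc_succ (m : ℕ) : cc (m + 1) = cc m *
    ((2 * m + 4/3) * (2 * m + 7/3) * (m + 2/3) / ((m + 1) * (2 * m + 1) * (2 * m + 2))) := by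
  have h1 := (poch_pos' 1 one_pos m).ne'
  have h2 := (poch_pos' 1 one_pos (2 * m)).ne'
  have h3 : (1 : ℝ) + m ≠ 0 := by positivity
  unfold cc
  rw [show 2 * (m + 1) = 2 * m + 1 + 1 by ring]
  simp only [poch_succ']
  push_cast
  field_simp
  ring

theorem ff_succ (m i : ℕ) : ff m (i + 1) = ff m i *
    ((1/3 + i) * (2/3 + i) * (-1/6 + i) / ((1 + i) * (-1/3 - 2 * m + i) * (2 * m + 1 + i))) := by
  unfold ff
  simp only [poch_succ']
  rw [mul_assoc (cc m), div_mul_div_comm]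
  congr 2 <;> ring

theorem ff_shift (m i : ℕ) : ff (m + 1) i = ff m i *
    ((m + 2/3) * (i - 7/3 - 2 * m) * (i - 4/3 - 2 * m) /
      ((m + 1) * (2 * m + 1 + i) * (2 * m + 2 + i))) := by
  induction i with
  | zero =>
    rw [ff_zero, ff_zero, cc_succ]
    congr 1
    push_cast
    congr 1 <;> ring
  | succ i ih =>
    rw [ff_succ, ih, ff_succ]
    have a1 := third_ne m i
    have a2 := third_ne (m + 1) i
    have a3 : (1 : ℝ) + i ≠ 0 := by positivity
    have a4 : (2 : ℝ) * m + 1 + i ≠ 0 := by positivity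
    have a5 : (2 : ℝ) * m + 2 + i ≠ 0 := by positivity
    have a6 : (2 : ℝ) * m + 3 + i ≠ 0 := by positivity
    have a7 : (m : ℝ) + 1 ≠ 0 := by positivity
    push_cast at a2 ⊢
    have e1 : (2 : ℝ) * (m + 1) + 1 + i = 2 * m + 3 + i := by ring
    have e2 : (2 : ℝ) * m + 1 + (i + 1) = 2 * m + 2 + i := by ring
    have e3 : (2 : ℝ) * m + 2 + (i + 1) = 2 * m + 3 + i := by ring
    have e4 : (-1/3 - 2 * ((m : ℝ) + 1) + i) = i - 7/3 - 2 * m := by ring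
    have e5 : ((i : ℝ) + 1 - 4/3 - 2 * m) = -1/3 - 2 * m + i := by ring
    have e6 : ((i : ℝ) + 1 - 7/3 - 2 * m) = i - 4/3 - 2 * m := by ring
    rw [e4] at a2
    rw [e1, e2, e3, e4, e5, e6]
    generalize ff m i = F
    generalize (-1/3 - 2 * (m : ℝ) + i) = u at *
    generalize ((i : ℝ) - 7/3 - 2 * m) = v at *
    generalize ((i : ℝ) - 4/3 - 2 * m) = w at *
    field_simp

/-- WZ mate. -/
noncomputable def gg (m i : ℕ) : ℝ :=
  -2 * i * (i - 4/3 - 2 * m) * ff m i / ((m + 1) * (2 * m + 1 + i))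

theorem wz (m i : ℕ) : ff (m + 1) i - ff m i = gg m (i + 1) - gg m i := by
  unfold gg
  rw [ff_shift, ff_succ]
  have a1 := third_ne m i
  have a3 : (1 : ℝ) + i ≠ 0 := by positivity
  have a4 : (2 : ℝ) * m + 1 + i ≠ 0 := by positivity
  have a5 : (2 : ℝ) * m + 2 + i ≠ 0 := by positivity
  have a7 : (m : ℝ) + 1 ≠ 0 := by positivity
  push_cast
  have e2 : (2 : ℝ) * m + 1 + (i + 1) = 2 * m + 2 + i := by ring
  have e5 : ((i : ℝ) + 1 - 4/3 - 2 * m) = -1/3 - 2 * m + i := by ring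
  rw [e2, e5]
  have key : -2 * ((i : ℝ) + 1) * (-1/3 - 2 * m + i) * (ff m i *
      ((1/3 + i) * (2/3 + i) * (-1/6 + i) / ((1 + i) * (-1/3 - 2 * m + i) * (2 * m + 1 + i)))) /
      ((m + 1) * (2 * m + 2 + i)) = -2 * ff m i * ((1/3 + i) * (2/3 + i) * (-1/6 + i)) /
      ((2 * m + 1 + i) * ((m + 1) * (2 * m + 2 + i))) := by
    generalize (-1/3 - 2 * (m : ℝ) + i) = u at *
    field_simp
    ring
  rw [key]
  field_simp
  ring

theorem diag (m : ℕ) :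
    ff m (m + 1) * ((m + 1/3) / (27 * (m + 1) ^ 2 * (3 * m + 2))) = - t0 (m + 1) := by
  induction m with
  | zero =>
    rw [ff_succ, ff_zero, cc_zero]
    simp [t0, poch]
    norm_num
  | succ m ih =>
    have ht : t0 (m + 1 + 1) = t0 (m + 1) *
        (-1/27 * ((m + 4/3) * (m + 2/3) * (m + 5/6)) / (m + 2) ^ 3) := by
      have h1 := (poch_pos' 1 one_pos (m + 1)).ne'
      unfold t0
      rw [poch_succ' _ (m + 1), poch_succ' _ (m + 1), poch_succ' _ (m + 1), poch_succ' _ (m + 1),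
        pow_succ]
      have a : (1 : ℝ) + ((m + 1 : ℕ) : ℝ) = m + 2 := by push_cast; ring
      have b : (m : ℝ) + 2 ≠ 0 := by positivity
      rw [a]
      push_cast
      field_simp
      ring
    rw [ht, ← neg_mul, ← ih, ff_succ, ff_shift]
    push_cast
    have e1 : (-1/3 - 2 * ((m : ℝ) + 1) + (m + 1)) = -(m + 4/3) := by ring
    have e2 : ((m : ℝ) + 1 - 7/3 - 2 * m) = - (m + 4/3) := by ring
    have e3 : ((m : ℝ) + 1 - 4/3 - 2 * m) = - (m + 1/3) := by ring
    rw [e1, e2, e3]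
    field_simp
    ring

theorem sum_eq (m : ℕ) : ∑ n ∈ Finset.range (m + 1), t0 n * (1 - 63 * (n : ℝ) ^ 2) =
    ∑ i ∈ Finset.range (m + 1), ff m i := by
  induction m with
  | zero => simp [ff_zero, cc_zero, t0, poch_zero']
  | succ m ih =>
    rw [Finset.sum_range_succ, ih]
    have h1 : ∑ i ∈ Finset.range (m + 1), (ff (m + 1) i - ff m i) = gg m (m + 1) := by
      simp only [wz]
      rw [Finset.sum_range_sub]
      simp [gg]
    rw [Finset.sum_sub_distrib] at h1
    rw [Finset.sum_range_succ _ (m + 1)]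
    have h2 : gg m (m + 1) + ff (m + 1) (m + 1) = t0 (m + 1) * (1 - 63 * ((m + 1 : ℕ) : ℝ) ^ 2) := by
      have h3 : t0 (m + 1) = - (ff m (m + 1) * ((m + 1/3) / (27 * (m + 1) ^ 2 * (3 * m + 2)))) := by
        rw [diag]; ring
      rw [h3, ff_shift, gg]
      push_cast
      field_simp
      ring
    linarith

theorem cc_pos (m : ℕ) : 0 < cc m := by
  unfold cc
  have h1 := poch_pos' (4/3) (by norm_num) (2 * m)
  have h2 := poch_pos' (2/3) (by norm_num) m
  have h3 := poch_pos' 1 one_pos m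
  have h4 := poch_pos' 1 one_pos (2 * m)
  positivity

theorem ff_bound (m i : ℕ) (h : i + 1 ≤ m) :
    |ff m (i + 1)| ≤ cc m / (m + 1) * (1/2) ^ (i + 1) := by
  have gen : ∀ j : ℕ, j + 1 ≤ m → |((1/3 + (j : ℝ)) * (2/3 + j) * (-1/6 + j) /
      ((1 + j) * (-1/3 - 2 * m + j) * (2 * m + 1 + j)))| =
      (1/3 + (j : ℝ)) * (2/3 + j) * |(-1/6 + (j : ℝ))| /
      ((1 + j) * (2 * m + 1/3 - j) * (2 * m + 1 + j)) := by
    intro j hj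
    have hj' : (j : ℝ) + 1 ≤ m := by exact_mod_cast hj
    rw [abs_div, abs_mul, abs_mul, abs_mul, abs_mul, abs_of_pos (by positivity : 0 < 1/3 + (j : ℝ)),
      abs_of_pos (by positivity : 0 < 2/3 + (j : ℝ)), abs_of_pos (by positivity : 0 < 1 + (j : ℝ)),
      abs_of_pos (by positivity : 0 < 2 * (m : ℝ) + 1 + j),
      abs_of_neg (by linarith : (-1/3 - 2 * (m : ℝ) + j) < 0)]
    congr 2
    ring
  induction i with
  | zero =>
    rw [ff_succ, ff_zero, abs_mul, gen 0 h, abs_of_pos (cc_pos m)]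
    have hm : (1 : ℝ) ≤ m := by exact_mod_cast h
    rw [show cc m / ((m : ℝ) + 1) * (1/2) ^ (0 + 1) = cc m * ((1/2) / (m + 1)) by ring]
    apply mul_le_mul_of_nonneg_left _ (cc_pos m).le
    have : |(-1/6 + ((0 : ℕ) : ℝ))| = 1/6 := by
      rw [abs_of_neg] <;> norm_num
    rw [this]
    push_cast
    rw [div_le_div_iff₀ (by nlinarith) (by positivity)]
    nlinarith
  | succ i ih =>
    rw [ff_succ, abs_mul, gen (i + 1) h, pow_succ, ← mul_assoc]
    have hj' : (i : ℝ) + 1 + 1 ≤ m := by exact_mod_cast h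
    have hi : (0 : ℝ) ≤ i := by positivity
    apply mul_le_mul (ih (by omega)) _ _ (by have := cc_pos m; positivity)
    · rw [abs_of_pos (by push_cast; linarith)]
      push_cast
      have p1 : (0 : ℝ) < 2 * m + 1/3 - (i + 1) := by linarith
      have p2 : (0 : ℝ) < 2 * m + 1 + (i + 1) := by positivity
      rw [div_le_div_iff₀ (by positivity) (by norm_num)]
      have q1 : (1/3 + ((i : ℝ) + 1)) * (2/3 + (i + 1)) ≤ (1 + (i + 1)) * (2 * m + 1/3 - (i + 1)) := by
        apply mul_le_mul <;> first | linarith | positivity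
      have q2 : (-1/6 + ((i : ℝ) + 1)) * 2 ≤ 2 * m + 1 + (i + 1) := by linarith
      have := mul_le_mul q1 q2 (by linarith) (by positivity)
      linarith
    · have p1 : (0 : ℝ) < 2 * m + 1/3 - ((i + 1 : ℕ) : ℝ) := by push_cast; linarith
      positivity

theorem poch_gamma (s : ℝ) (hs : 0 < s) (n : ℕ) :
    poch s n = (n : ℝ) ^ s * (n.factorial : ℝ) / (Real.GammaSeq s n * (s + n)) ∨ n = 0 := by
  rcases Nat.eq_zero_or_pos n with h | h
  · exact Or.inr h
  left
  have hp := poch_pos' s hs n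
  have hn : (0 : ℝ) < n := by exact_mod_cast h
  have h1 : (0 : ℝ) < (n : ℝ) ^ s := Real.rpow_pos_of_pos hn s
  have h2 : (0 : ℝ) < n.factorial := by exact_mod_cast n.factorial_pos
  have h3 : ∏ j ∈ Finset.range (n + 1), (s + (j : ℝ)) = poch s n * (s + n) := by
    rw [Finset.prod_range_succ, poch]
  unfold Real.GammaSeq
  rw [h3]
  have : s + n ≠ 0 := by positivity
  field_simp

theorem poch_one (n : ℕ) : poch 1 n = n.factorial := by
  induction n with
  | zero => simp [poch]
  | succ n ih => rw [poch_succ', ih, Nat.factorial_succ]; push_cast; ring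

theorem cc_tendsto : Filter.Tendsto cc Filter.atTop
    (nhds (2 ^ ((4 : ℝ)/3) / (Real.Gamma (4/3) * Real.Gamma (2/3)) * (1/2))) := by
  have g1 : Filter.Tendsto (fun m : ℕ => Real.GammaSeq (4/3) (2 * m)) Filter.atTop
      (nhds (Real.Gamma (4/3))) :=
    (Real.GammaSeq_tendsto_Gamma (4/3)).comp
      (Filter.tendsto_id.const_mul_atTop' (by norm_num : 0 < 2))
  have g2 := Real.GammaSeq_tendsto_Gamma (2/3)
  have p1 : Real.Gamma (4/3) ≠ 0 := (Real.Gamma_pos_of_pos (by norm_num)).ne'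
  have p2 : Real.Gamma (2/3) ≠ 0 := (Real.Gamma_pos_of_pos (by norm_num)).ne'
  have g3 : Filter.Tendsto (fun m : ℕ => (1 : ℝ) / ((4/3 * (1 / (m : ℝ)) + 2) * (2/3 * (1 / (m : ℝ)) + 1)))
      Filter.atTop (nhds (1/2)) := by
    have h0 := tendsto_one_div_atTop_nhds_zero_nat (𝕜 := ℝ)
    have h1 := (((h0.const_mul (4/3)).add_const 2).mul ((h0.const_mul (2/3)).add_const 1))
    have h2 := h1.inv₀ (by norm_num)
    simp only [one_div] at h2 ⊢
    convert h2 using 2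
    norm_num
  have g4 := ((tendsto_const_nhds (x := (2 : ℝ) ^ ((4 : ℝ)/3))).div (g1.mul g2) (mul_ne_zero p1 p2)).mul g3
  refine g4.congr' ?_
  filter_upwards [Filter.eventually_gt_atTop 0] with m hm
  have hm' : (0 : ℝ) < m := by exact_mod_cast hm
  have e1 := (poch_gamma (4/3) (by norm_num) (2 * m)).resolve_right (by omega)
  have e2 := (poch_gamma (2/3) (by norm_num) m).resolve_right (by omega)
  have f1 : (0 : ℝ) < (2 * m).factorial := by exact_mod_cast (2 * m).factorial_pos
  have f2 : (0 : ℝ) < m.factorial := by exact_mod_cast m.factorial_pos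
  simp only [Pi.div_apply]
  unfold cc
  rw [e1, e2, poch_one, poch_one]
  push_cast
  rw [Real.mul_rpow (by norm_num) hm'.le]
  have e3 : (m : ℝ) ^ ((4 : ℝ)/3) * (m : ℝ) ^ ((2 : ℝ)/3) = m ^ 2 := by
    rw [← Real.rpow_add hm', ← Real.rpow_natCast]
    norm_num
  have e4 : (2 : ℝ) ^ ((4 : ℝ)/3) * (m : ℝ) ^ ((4 : ℝ)/3) * ((2 * m).factorial : ℝ) /
      (Real.GammaSeq (4/3) (2 * m) * (4/3 + 2 * m)) *
      ((m : ℝ) ^ ((2 : ℝ)/3) * (m.factorial : ℝ) / (Real.GammaSeq (2/3) m * (2/3 + m))) =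
      (2 : ℝ) ^ ((4 : ℝ)/3) * ((m : ℝ) ^ ((4 : ℝ)/3) * (m : ℝ) ^ ((2 : ℝ)/3)) *
      ((2 * m).factorial : ℝ) * (m.factorial : ℝ) /
      (Real.GammaSeq (4/3) (2 * m) * (4/3 + 2 * m) * (Real.GammaSeq (2/3) m * (2/3 + m))) := by
    rw [div_mul_div_comm]
    congr 1
    ring
  rw [e4, e3]
  have n1 : (4/3 + 2 * (m : ℝ)) ≠ 0 := by positivity
  have n2 : (2/3 + (m : ℝ)) ≠ 0 := by positivity
  have e5 : (1 : ℝ) / ((4/3 * (1 / (m : ℝ)) + 2) * (2/3 * (1 / (m : ℝ)) + 1)) =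
      m ^ 2 / ((4/3 + 2 * m) * (2/3 + m)) := by
    field_simp
  rw [e5]
  generalize (2 : ℝ) ^ ((4 : ℝ)/3) = A
  generalize (4/3 + 2 * (m : ℝ)) = B at *
  generalize (2/3 + (m : ℝ)) = D at *
  rw [div_mul_div_comm, div_div, mul_assoc (A * (m : ℝ) ^ 2)]
  rw [mul_comm ((2 * m).factorial : ℝ) (m.factorial : ℝ)]
  rw [mul_div_mul_right _ _ (by positivity)]
  congr 1
  ring

theorem sum_tendsto : Filter.Tendsto (fun m => ∑ i ∈ Finset.range (m + 1), ff m i) Filter.atTop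
    (nhds (2 ^ ((4 : ℝ)/3) / (Real.Gamma (4/3) * Real.Gamma (2/3)) * (1/2))) := by
  have h0 := tendsto_one_div_add_atTop_nhds_zero_nat (𝕜 := ℝ)
  have h1 := cc_tendsto.mul h0
  rw [mul_zero] at h1
  have h2 : Filter.Tendsto (fun m => ∑ i ∈ Finset.range m, ff m (i + 1)) Filter.atTop (nhds 0) := by
    apply squeeze_zero_norm _ h1
    intro m
    calc ‖∑ i ∈ Finset.range m, ff m (i + 1)‖ ≤ ∑ i ∈ Finset.range m, ‖ff m (i + 1)‖ :=
          norm_sum_le _ _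
      _ ≤ ∑ i ∈ Finset.range m, cc m / (m + 1) * (1/2) ^ (i + 1) := by
          apply Finset.sum_le_sum
          intro i hi
          exact ff_bound m i (by simpa [Nat.succ_le_iff] using hi)
      _ = cc m / (m + 1) * (1 - (1/2) ^ m) := by
          rw [← Finset.mul_sum]
          congr 1
          clear h1 h0
          induction m with
          | zero => simp
          | succ m ih => rw [Finset.sum_range_succ, ih]; ring
      _ ≤ cc m * (1 / ((m : ℝ) + 1)) := by
          rw [mul_one_div]
          apply mul_le_of_le_one_right
          · have := cc_pos m
            positivity
          · have : (0 : ℝ) < (1/2) ^ m := by positivity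
            linarith
  have h3 := h2.add cc_tendsto
  rw [zero_add] at h3
  refine h3.congr fun m => ?_
  rw [Finset.sum_range_succ', ff_zero]

theorem abs_poch_le (x : ℝ) (h1 : -1 ≤ x) (h2 : x ≤ 1) (n : ℕ) : |poch x n| ≤ poch 1 n := by
  unfold poch
  rw [Finset.abs_prod]
  apply Finset.prod_le_prod
  · intros; positivity
  · intro k _
    have : (0 : ℝ) ≤ k := by positivity
    rw [abs_le]
    constructor <;> linarith

theorem summ : Summable fun n : ℕ => t0 n * (1 - 63 * (n : ℝ) ^ 2) := by
  have s1 := summable_pow_mul_geometric_of_norm_lt_one 0 (r := (1/27 : ℝ)) (by norm_num)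
  have s2 := (summable_pow_mul_geometric_of_norm_lt_one 2 (r := (1/27 : ℝ)) (by norm_num)).mul_left 63
  refine Summable.of_norm_bounded (s1.add s2) fun n => ?_
  have hp := poch_pos' 1 one_pos n
  have b : |t0 n| ≤ (1/27 : ℝ) ^ n := by
    unfold t0
    have : |(-1/27 : ℝ)| = 1/27 := by rw [abs_of_neg] <;> norm_num
    rw [abs_mul, abs_pow, this, abs_div, abs_mul, abs_mul, abs_of_pos (pow_pos hp 3)]
    apply mul_le_of_le_one_right (by positivity)
    rw [div_le_one (pow_pos hp 3)]
    have q1 := abs_poch_le (1/3) (by norm_num) (by norm_num) n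
    have q2 := abs_poch_le (-1/3) (by norm_num) (by norm_num) n
    have q3 := abs_poch_le (-1/6) (by norm_num) (by norm_num) n
    calc _ ≤ poch 1 n * poch 1 n * poch 1 n := by gcongr
      _ = _ := by ring
  have b2 : |1 - 63 * (n : ℝ) ^ 2| ≤ 1 + 63 * (n : ℝ) ^ 2 := by
    have : (0 : ℝ) ≤ (n : ℝ) ^ 2 := by positivity
    rw [abs_le]; constructor <;> linarith
  rw [Real.norm_eq_abs, abs_mul]
  calc _ ≤ (1/27 : ℝ) ^ n * (1 + 63 * (n : ℝ) ^ 2) := by gcongr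
    _ = _ := by ring

theorem gamma_val : (2 : ℝ) ^ ((4 : ℝ)/3) / (Real.Gamma (4/3) * Real.Gamma (2/3)) * (1/2) =
    3 * Real.sqrt 3 / (π * (4 : ℝ) ^ ((1 : ℝ) / 3)) := by
  have h1 : Real.Gamma (4/3) = 1/3 * Real.Gamma (1/3) := by
    rw [← Real.Gamma_add_one (by norm_num)]; norm_num
  have h2 := Real.Gamma_mul_Gamma_one_sub (1/3)
  rw [show (1 : ℝ) - 1/3 = 2/3 by norm_num, show π * (1/3) = π / 3 by ring, Real.sin_pi_div_three] at h2
  rw [h1, mul_assoc, h2]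
  have h4 : (4 : ℝ) ^ ((1 : ℝ)/3) = 2 ^ ((2 : ℝ)/3) := by
    rw [show (4 : ℝ) = 2 ^ (2 : ℝ) by norm_num, ← Real.rpow_mul (by norm_num)]
    norm_num
  have h5 : (2 : ℝ) ^ ((4 : ℝ)/3) * 2 ^ ((2 : ℝ)/3) = 4 := by
    rw [← Real.rpow_add (by norm_num)]
    norm_num
  rw [h4]
  have h6 : (0 : ℝ) < 2 ^ ((2 : ℝ)/3) := by positivity
  have h7 : (2 : ℝ) ^ ((4 : ℝ)/3) = 4 / 2 ^ ((2 : ℝ)/3) := by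
    rw [eq_div_iff h6.ne', h5]
  rw [h7]
  have := Real.pi_pos
  have h8 : (0 : ℝ) < Real.sqrt 3 := by positivity
  field_simp
  norm_num

theorem series_3sqrt3 :
    3 * Real.sqrt 3 / (π * (4 : ℝ) ^ ((1 : ℝ) / 3)) = ∑' n : ℕ, (-1/27 : ℝ) ^ n *
      (poch (1/3) n * poch (-1/3) n * poch (-1/6) n / poch 1 n ^ 3) *
      (1 - 63 * (n : ℝ) ^ 2) := by
  rw [← gamma_val]
  have h1 := summ.hasSum.tendsto_sum_nat
  have h2 := h1.comp (Filter.tendsto_add_atTop_nat 1)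
  have h3 := sum_tendsto
  simp only [← sum_eq] at h3
  exact tendsto_nhds_unique h3 h2
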